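/- arXiv:1807.05961 — 2 statements merged into one kernel-verified Lean document; each statement's English description precedes it below -/
import Mathlib

section
/- For every n ≥ 1, t > 0 and every z ∈ ℝ with z ≠ 0, one has (1/h_{n−1}(t)) ∫_ℝ (v'(z) − v'(y))/(z − y) · P_n(y) P_{n−1}(y) w(y,t) dy = r_n(t)/z + (1 − (−1)^n) t / z³, where v'(x) = 2x − 2t/x³ (so that for y ≠ z, (v'(z) − v'(y))/(z − y) = 2 + 2t/(z y³) + 2t/(z² y²) + 2t/(z³ y)). -/
open MeasureTheory Polynomial

/-- The singularly perturbed Gaussian weight `w(x,t) = exp(-x^2 - t/x^2)` for `x ≠ 0`,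
extended by `0` at `x = 0`. -/
noncomputable def w (t x : ℝ) : ℝ := if x = 0 then 0 else Real.exp (-x ^ 2 - t / x ^ 2)

theorem w_neg (t x : ℝ) : w t (-x) = w t x := by
  simp [w]

theorem measurable_w (t : ℝ) : Measurable (w t) := by
  unfold w
  exact Measurable.ite (measurableSet_singleton 0) measurable_const (by fun_prop)

theorem abs_inv_pow_four_mul_w_le {t : ℝ} (ht : 0 < t) (x : ℝ) :
    |(x ^ 4)⁻¹ * w t x| ≤ 2 / t ^ 2 * Real.exp (-x ^ 2) := by
  by_cases hx : x = 0
  · simp only [w, hx, if_true, mul_zero, abs_zero]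
    positivity
  · have hquad := Real.quadratic_le_exp_of_nonneg (x := t / x ^ 2) (by positivity)
    have hle : (t / x ^ 2) ^ 2 / 2 ≤ Real.exp (t / x ^ 2) := by
      have : 0 ≤ t / x ^ 2 := by positivity
      linarith
    rw [w, if_neg hx, abs_of_nonneg (by positivity), sub_eq_add_neg, Real.exp_add,
      Real.exp_neg (t / x ^ 2)]
    have hinv := inv_anti₀ (by positivity) hle
    have hconst : (x ^ 4)⁻¹ * ((t / x ^ 2) ^ 2 / 2)⁻¹ = 2 / t ^ 2 := by
      field_simp
    calc (x ^ 4)⁻¹ * (Real.exp (-x ^ 2) * (Real.exp (t / x ^ 2))⁻¹)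
        ≤ (x ^ 4)⁻¹ * (Real.exp (-x ^ 2) * ((t / x ^ 2) ^ 2 / 2)⁻¹) := by gcongr
      _ = 2 / t ^ 2 * Real.exp (-x ^ 2) := by rw [← hconst]; ring

theorem integrable_polynomial_mul_exp_neg_sq (p : ℝ[X]) :
    Integrable fun x : ℝ => p.eval x * Real.exp (-x ^ 2) := by
  simp only [eval_eq_sum_range, Finset.sum_mul]
  refine integrable_finsetSum _ fun i _ => ?_
  have := (integrable_rpow_mul_exp_neg_mul_sq one_pos (s := (i : ℝ))
    (by linarith [(Nat.cast_nonneg i : (0 : ℝ) ≤ i)])).const_mul (p.coeff i)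
  simpa [mul_assoc] using this

theorem integrable_polynomial_div_pow_four_mul_w {t : ℝ} (ht : 0 < t) (p : ℝ[X]) :
    Integrable fun x : ℝ => p.eval x / x ^ 4 * w t x := by
  refine ((integrable_polynomial_mul_exp_neg_sq p).const_mul (2 / t ^ 2)).norm.mono'
    ((p.continuous.measurable.div (by fun_prop)).mul (measurable_w t)).aestronglyMeasurable
    (Filter.Eventually.of_forall fun x => ?_)
  have hx := abs_inv_pow_four_mul_w_le ht x
  rw [div_eq_mul_inv, mul_assoc, norm_mul, Real.norm_eq_abs ((x ^ 4)⁻¹ * w t x), norm_mul,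
    norm_mul, Real.norm_of_nonneg (show 0 ≤ 2 / t ^ 2 by positivity),
    Real.norm_of_nonneg (Real.exp_pos _).le]
  calc ‖p.eval x‖ * |(x ^ 4)⁻¹ * w t x|
      ≤ ‖p.eval x‖ * (2 / t ^ 2 * Real.exp (-x ^ 2)) := by gcongr
    _ = _ := by ring

theorem integrable_polynomial_div_pow_mul_w {t : ℝ} (ht : 0 < t) (p : ℝ[X]) {k : ℕ}
    (hk : k ≤ 4) : Integrable fun x : ℝ => p.eval x / x ^ k * w t x := by
  refine (integrable_polynomial_div_pow_four_mul_w ht (p * X ^ (4 - k))).congr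
    (Filter.Eventually.of_forall fun x => ?_)
  by_cases hx : x = 0
  · simp [w, hx]
  · have : x ^ 4 = x ^ (4 - k) * x ^ k := by rw [← pow_add, Nat.sub_add_cancel hk]
    simp only [eval_mul, eval_pow, eval_X, this]
    field_simp

theorem integrable_polynomial_mul_w {t : ℝ} (ht : 0 < t) (p : ℝ[X]) :
    Integrable fun x : ℝ => p.eval x * w t x := by
  simpa using integrable_polynomial_div_pow_mul_w ht p (Nat.zero_le 4)

/-- Integration of polynomials against the weight `w t`. -/
noncomputable def weightIntegral {t : ℝ} (ht : 0 < t) : ℝ[X] →ₗ[ℝ] ℝ where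
  toFun p := ∫ x : ℝ, p.eval x * w t x
  map_add' p q := by
    simp only [eval_add, add_mul]
    exact integral_add (integrable_polynomial_mul_w ht p) (integrable_polynomial_mul_w ht q)
  map_smul' c p := by
    simp only [eval_smul, smul_eq_mul, mul_assoc, integral_const_mul, RingHom.id_apply]

theorem weightIntegral_apply {t : ℝ} (ht : 0 < t) (p : ℝ[X]) :
    weightIntegral ht p = ∫ x : ℝ, p.eval x * w t x := rfl

theorem weightIntegral_comp_neg_X {t : ℝ} (ht : 0 < t) (p : ℝ[X]) :
    weightIntegral ht (p.comp (-X)) = weightIntegral ht p := by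
  simp only [weightIntegral_apply, eval_comp, eval_neg, eval_X]
  rw [← integral_neg_eq_self]
  simp [w_neg]

section Orthogonal

variable {P : ℕ → ℝ[X]} {L : ℝ[X] →ₗ[ℝ] ℝ}

theorem degree_sub_C_coeff_mul_lt {p q : ℝ[X]} {n : ℕ} (hq : q.Monic)
    (hqn : q.natDegree = n) (hp : p.natDegree ≤ n) :
    (p - C (p.coeff n) * q).degree < n := by
  rw [degree_lt_iff_coeff_zero]
  intro m hm
  rcases hm.eq_or_lt with rfl | hlt
  · have : q.coeff n = 1 := by rw [← hqn]; exact hq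
    simp [this]
  · rw [coeff_sub, coeff_C_mul, coeff_eq_zero_of_natDegree_lt (hp.trans_lt hlt),
      coeff_eq_zero_of_natDegree_lt (hqn.trans_lt hlt)]
    simp

theorem orthogonal_of_degree_lt (hmonic : ∀ n, (P n).Monic) (hdeg : ∀ n, (P n).natDegree = n)
    (horth : ∀ m n, m ≠ n → L (P m * P n) = 0) (n : ℕ) :
    ∀ k ≤ n, ∀ q : ℝ[X], q.degree < k → L (P n * q) = 0 := by
  intro k
  induction k with
  | zero =>
    intro _ q hq
    have : q = 0 := by simpa [degree_lt_iff_coeff_zero, Polynomial.ext_iff] using hq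
    simp [this]
  | succ k ih =>
    intro hk q hq
    have hqk : q.natDegree ≤ k := by
      rw [natDegree_le_iff_coeff_eq_zero]
      exact fun m hm => (degree_lt_iff_coeff_zero _ _).1 hq m hm
    have hlow := ih (by omega) _ (degree_sub_C_coeff_mul_lt (hmonic k) (hdeg k) hqk)
    have hsplit : P n * q =
        P n * (q - C (q.coeff k) * P k) + q.coeff k • (P n * P k) := by
      rw [smul_eq_C_mul]; ring
    rw [hsplit, map_add, map_smul, hlow, horth n k (by omega)]
    simp

theorem orthogonal_mul_of_natDegree_le (hmonic : ∀ n, (P n).Monic)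
    (hdeg : ∀ n, (P n).natDegree = n) (horth : ∀ m n, m ≠ n → L (P m * P n) = 0) {n : ℕ}
    {q : ℝ[X]} (hq : q.natDegree ≤ n) : L (P n * q) = q.coeff n * L (P n * P n) := by
  have hlow := orthogonal_of_degree_lt hmonic hdeg horth n n le_rfl _
    (degree_sub_C_coeff_mul_lt (hmonic n) (hdeg n) hq)
  have hsplit : P n * q =
      P n * (q - C (q.coeff n) * P n) + q.coeff n • (P n * P n) := by
    rw [smul_eq_C_mul]; ring
  rw [hsplit, map_add, map_smul, hlow, zero_add, smul_eq_mul]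

theorem orthogonal_comp_neg_X (hmonic : ∀ n, (P n).Monic) (hdeg : ∀ n, (P n).natDegree = n)
    (horth : ∀ m n, m ≠ n → L (P m * P n) = 0) (hpos : ∀ n, 0 < L (P n * P n))
    (hL : ∀ p, L (p.comp (-X)) = L p) (n : ℕ) :
    (P n).comp (-X) = (-1) ^ n * P n := by
  have hcomp (p : ℝ[X]) : (p.comp (-X)).natDegree = p.natDegree := by simp [natDegree_comp]
  have hlead : ((P n).comp (-X)).coeff n = (-1) ^ n := by
    have hlc := comp_neg_X_leadingCoeff_eq (P n)
    rwa [(hmonic n).leadingCoeff, mul_one, leadingCoeff, hcomp, hdeg] at hlc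
  have hDdeg : ((P n).comp (-X) - C ((-1) ^ n) * P n).degree < (n : WithBot ℕ) := by
    rw [← hlead]
    exact degree_sub_C_coeff_mul_lt (hmonic n) (hdeg n) (by rw [hcomp, hdeg])
  set D := (P n).comp (-X) - C ((-1) ^ n) * P n with hD
  suffices hD0 : D = 0 by
    rw [hD, sub_eq_zero] at hD0
    simpa using hD0
  by_contra hne
  have hk : D.natDegree < n := (natDegree_lt_iff_degree_lt hne).2 hDdeg
  have hPk : (P D.natDegree).degree < n := by
    rw [degree_eq_natDegree (hmonic _).ne_zero, hdeg]
    exact_mod_cast hk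
  have hzero : L (P D.natDegree * D) = 0 := by
    have hreflect : L (P D.natDegree * (P n).comp (-X)) = 0 := by
      rw [← hL, mul_comp_neg_X, comp_neg_X_comp_neg_X, mul_comm]
      exact orthogonal_of_degree_lt hmonic hdeg horth n n le_rfl _ (by rwa [degree_comp_neg_X])
    have hsplit : P D.natDegree * D = P D.natDegree * (P n).comp (-X)
        - ((-1 : ℝ) ^ n) • (P D.natDegree * P n) := by
      rw [hD, smul_eq_C_mul, mul_sub]; ring
    rw [hsplit, map_sub, map_smul, hreflect, horth _ _ hk.ne]
    simp
  rw [orthogonal_mul_of_natDegree_le hmonic hdeg horth le_rfl] at hzero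
  exact mul_ne_zero (leadingCoeff_ne_zero.2 hne) (hpos _).ne' hzero

theorem X_mul_divX_of_comp_neg_X {p : ℝ[X]} (hp : p.comp (-X) = -p) : X * p.divX = p := by
  have h0 : p.coeff 0 = 0 := by
    have heval := congrArg (eval 0) hp
    simp only [eval_comp, eval_neg, eval_X, neg_zero] at heval
    rw [coeff_zero_eq_eval_zero]
    linarith
  simpa [h0] using X_mul_divX_add p

end Orthogonal

theorem integral_div_X_mul_w {t : ℝ} (ht : 0 < t) {p q s : ℝ[X]} (hs : p * q = X * s) :
    ∫ y : ℝ, (p * q).eval y / y ^ 1 * w t y = weightIntegral ht s := by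
  rw [weightIntegral_apply]
  congr 1 with y
  by_cases hy : y = 0
  · simp [w, hy]
  · rw [hs, eval_mul, eval_X]
    field_simp

theorem integral_eq_zero_of_odd {f : ℝ → ℝ} (hf : ∀ x, f (-x) = -f x) : ∫ x, f x = 0 := by
  have := integral_neg_eq_self f volume
  simp only [hf, integral_neg] at this
  linarith

theorem statement1
    (t : ℝ) (ht : 0 < t)
    (P : ℕ → Polynomial ℝ)
    (hmonic : ∀ n, (P n).Monic)
    (hdeg : ∀ n, (P n).natDegree = n)
    (horth : ∀ m n : ℕ, m ≠ n → ∫ x : ℝ, (P m).eval x * (P n).eval x * w t x = 0)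
    (h : ℕ → ℝ)
    (hh : ∀ n, h n = ∫ x : ℝ, ((P n).eval x) ^ 2 * w t x)
    (hhpos : ∀ n, 0 < h n)
    (r : ℕ → ℝ)
    (hr : ∀ n, 1 ≤ n → r n = 2 * t / h (n - 1) *
      ∫ y : ℝ, (P n).eval y * (P (n - 1)).eval y / y ^ 3 * w t y)
    (n : ℕ) (hn : 1 ≤ n) (z : ℝ) (hz : z ≠ 0) :
    (1 / h (n - 1)) * ∫ y : ℝ,
        ((2 * z - 2 * t / z ^ 3) - (2 * y - 2 * t / y ^ 3)) / (z - y)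
          * (P n).eval y * (P (n - 1)).eval y * w t y
      = r n / z + (1 - (-1 : ℝ) ^ n) * t / z ^ 3 := by
  obtain ⟨n, rfl⟩ : ∃ m, n = m + 1 := ⟨n - 1, by omega⟩
  rw [Nat.add_sub_cancel]
  have horthL : ∀ m n, m ≠ n → weightIntegral ht (P m * P n) = 0 := fun m n hmn => by
    simpa only [weightIntegral_apply, eval_mul] using horth m n hmn
  have hnorm (m : ℕ) : weightIntegral ht (P m * P m) = h m := by
    simp only [weightIntegral_apply, eval_mul, hh m, sq]
  have hparity := orthogonal_comp_neg_X hmonic hdeg horthL (fun m => (hnorm m).symm ▸ hhpos m)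
    (weightIntegral_comp_neg_X ht)
  have heval (m : ℕ) (y : ℝ) : (P m).eval (-y) = (-1) ^ m * (P m).eval y := by
    simpa using congrArg (eval y) (hparity m)
  set Q := P (n + 1) * P n with hQ
  have hI0 : ∫ y : ℝ, Q.eval y / y ^ 0 * w t y = 0 := by
    simpa [weightIntegral_apply, hQ] using horthL (n + 1) n (by omega)
  have hI2 : ∫ y : ℝ, Q.eval y / y ^ 2 * w t y = 0 := by
    refine integral_eq_zero_of_odd fun y => ?_
    have : ((-1 : ℝ) ^ n) * (-1) ^ n = 1 := by rw [← mul_pow]; simp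
    rw [hQ, w_neg, eval_mul, eval_mul, heval, heval, pow_succ]
    linear_combination (-((P (n + 1)).eval y * (P n).eval y / y ^ 2 * w t y)) * this
  have hI1 : 2 * ∫ y : ℝ, Q.eval y / y ^ 1 * w t y = (1 - (-1) ^ (n + 1)) * h n := by
    rcases Nat.even_or_odd n with he | ho
    · have hX : X * (P (n + 1)).divX = P (n + 1) :=
        X_mul_divX_of_comp_neg_X (by rw [hparity, he.add_one.neg_one_pow]; ring)
      have hlead : (P (n + 1)).divX.coeff n = 1 := by
        have := hmonic (n + 1)
        rwa [Monic, leadingCoeff, hdeg, ← coeff_divX] at this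
      rw [integral_div_X_mul_w ht (s := P n * (P (n + 1)).divX)
        (by nth_rw 1 [← hX]; ring),
        orthogonal_mul_of_natDegree_le hmonic hdeg horthL
          (by rw [natDegree_divX_eq_natDegree_tsub_one, hdeg]; simp),
        hlead, hnorm, he.add_one.neg_one_pow]
      ring
    · have hX : X * (P n).divX = P n :=
        X_mul_divX_of_comp_neg_X (by rw [hparity, ho.neg_one_pow]; ring)
      have hle : (P n).divX.natDegree ≤ n - 1 := by
        rw [natDegree_divX_eq_natDegree_tsub_one, hdeg]
      rw [integral_div_X_mul_w ht (s := P (n + 1) * (P n).divX)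
        (by nth_rw 1 [← hX]; ring),
        orthogonal_mul_of_natDegree_le hmonic hdeg horthL (by omega),
        coeff_eq_zero_of_natDegree_lt (by omega), ho.add_one.neg_one_pow]
      ring
  have hr' : r (n + 1) = 2 * t / h n * ∫ y : ℝ, Q.eval y / y ^ 3 * w t y := by
    simpa only [hQ, eval_mul, Nat.add_sub_cancel] using hr (n + 1) (by omega)
  have hint (k : ℕ) (hk : k ≤ 4) (c : ℝ) :
      Integrable fun y : ℝ => c * (Q.eval y / y ^ k * w t y) :=
    (integrable_polynomial_div_pow_mul_w ht Q hk).const_mul c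
  have hkernel : ∫ y : ℝ, ((2 * z - 2 * t / z ^ 3) - (2 * y - 2 * t / y ^ 3)) / (z - y)
          * (P (n + 1)).eval y * (P n).eval y * w t y
      = ∫ y : ℝ, (2 * (Q.eval y / y ^ 0 * w t y) + 2 * t / z * (Q.eval y / y ^ 3 * w t y)
          + 2 * t / z ^ 2 * (Q.eval y / y ^ 2 * w t y)
          + 2 * t / z ^ 3 * (Q.eval y / y ^ 1 * w t y)) := by
    refine integral_congr_ae ?_
    filter_upwards [Measure.ae_ne volume z] with y hy
    by_cases hy0 : y = 0
    · simp [w, hy0]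
    · have hzy : z - y ≠ 0 := sub_ne_zero.2 hy.symm
      rw [hQ, eval_mul]
      field_simp
      ring
  rw [hkernel, integral_add (((hint 0 (by omega) _).fun_add (hint 3 (by omega) _)).fun_add
      (hint 2 (by omega) _)) (hint 1 (by omega) _),
    integral_add ((hint 0 (by omega) _).fun_add (hint 3 (by omega) _)) (hint 2 (by omega) _),
    integral_add (hint 0 (by omega) _) (hint 3 (by omega) _)]
  simp only [integral_const_mul]
  rw [hI0, hI2, hr']
  have hhn := (hhpos n).ne'
  generalize (∫ y : ℝ, Q.eval y / y ^ 1 * w t y) = I₁ at hI1 ⊢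
  generalize (∫ y : ℝ, Q.eval y / y ^ 3 * w t y) = I₃
  field_simp
  linear_combination t * hI1
end

section
/- For every n ≥ 1 and t > 0, β_n(t) = (n + r_n(t))/2. -/
open MeasureTheory Polynomial

theorem integrable_eval_mul_of_abs_le_gaussian (p : ℝ[X]) {g : ℝ → ℝ} {C : ℝ}
    (hg : Measurable g) (hC : ∀ x, |g x| ≤ C * Real.exp (-x ^ 2)) :
    Integrable fun x => p.eval x * g x := by
  induction p using Polynomial.induction_on' with
  | add p q hp hq => exact (hp.add hq).congr (.of_forall fun x => by simp [add_mul])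
  | monomial k a =>
    have hk : Integrable fun x : ℝ => x ^ k * Real.exp (-1 * x ^ 2) := by
      simpa only [Real.rpow_natCast] using
        integrable_rpow_mul_exp_neg_mul_sq one_pos (s := (k : ℝ))
          (by linarith [k.cast_nonneg (α := ℝ)])
    refine (hk.const_mul (a * C)).mono
      ((by fun_prop : Measurable fun x => (monomial k a).eval x * g x).aestronglyMeasurable) ?_
    filter_upwards with x
    have hx : |g x| ≤ |C| * Real.exp (-x ^ 2) :=
      (hC x).trans (mul_le_mul_of_nonneg_right (le_abs_self C) (Real.exp_pos _).le)
    simp only [eval_monomial, Real.norm_eq_abs, abs_mul, Real.abs_exp, neg_one_mul]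
    calc |a| * |x ^ k| * |g x| ≤ |a| * |x ^ k| * (|C| * Real.exp (-x ^ 2)) := by gcongr
      _ = _ := by ring

theorem w_nonneg (t x : ℝ) : 0 ≤ w t x := by
  unfold w
  split_ifs <;> positivity

theorem w_eq_of_ne (t : ℝ) {x : ℝ} (hx : x ≠ 0) :
    w t x = Real.exp (-x ^ 2) * Real.exp (-(t / x ^ 2)) := by
  rw [w, if_neg hx, ← Real.exp_add, sub_eq_add_neg]

theorem abs_w_le {t : ℝ} (ht : 0 < t) (x : ℝ) : |w t x| ≤ 1 * Real.exp (-x ^ 2) := by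
  rw [abs_of_nonneg (w_nonneg t x), one_mul]
  rcases eq_or_ne x 0 with rfl | hx
  · simp [w]
  · rw [w_eq_of_ne t hx]
    exact mul_le_of_le_one_right (Real.exp_pos _).le
      (Real.exp_le_one_iff.2 (neg_nonpos.2 (by positivity)))

theorem w_le_sq_div {t : ℝ} (ht : 0 < t) (x : ℝ) : w t x ≤ x ^ 2 / t := by
  rcases eq_or_ne x 0 with rfl | hx
  · simp [w]
  · have h1 : Real.exp (-x ^ 2) ≤ 1 := Real.exp_le_one_iff.2 (by nlinarith [sq_nonneg x])
    have hu : 0 < t / x ^ 2 := by positivity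
    have h2 : Real.exp (-(t / x ^ 2)) ≤ x ^ 2 / t := by
      rw [Real.exp_neg, ← inv_div t]
      exact inv_anti₀ hu (by linarith [Real.add_one_le_exp (t / x ^ 2)])
    rw [w_eq_of_ne t hx]
    exact (mul_le_of_le_one_left (Real.exp_pos _).le h1).trans h2

theorem abs_w_div_cube_le {t : ℝ} (ht : 0 < t) (x : ℝ) :
    |w t x / x ^ 3| ≤ (1 + 2 / t ^ 2) * Real.exp (-x ^ 2) := by
  rcases eq_or_ne x 0 with rfl | hx
  · simp only [w, if_true, zero_div, abs_zero]
    positivity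
  have hy : 0 < |x| := abs_pos.2 hx
  set E := Real.exp (-(t / x ^ 2)) with hE
  have hE1 : E ≤ 1 := Real.exp_le_one_iff.2 (neg_nonpos.2 (by positivity))
  have hE0 : 0 < E := Real.exp_pos _
  have hE2 : E / x ^ 4 ≤ 2 / t ^ 2 := by
    have hq := Real.quadratic_le_exp_of_nonneg (x := t / x ^ 2) (by positivity)
    have hu : 0 < t / x ^ 2 := by positivity
    have hle : (t / x ^ 2) ^ 2 / 2 ≤ E⁻¹ := by
      rw [hE, Real.exp_neg, inv_inv]
      linarith
    have := mul_le_mul_of_nonneg_left hle hE0.le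
    rw [mul_inv_cancel₀ hE0.ne'] at this
    rw [le_div_iff₀ (by positivity)]
    have e : E * ((t / x ^ 2) ^ 2 / 2) = E / x ^ 4 * t ^ 2 / 2 := by
      field_simp
    linarith
  have hcube : 1 / |x| ^ 3 ≤ 1 + 1 / x ^ 4 := by
    rw [← (show Even 4 by decide).pow_abs x, div_le_iff₀ (by positivity)]
    have e : (1 + 1 / |x| ^ 4) * |x| ^ 3 = |x| ^ 3 + 1 / |x| := by
      field_simp
    rw [e]
    rcases le_total 1 |x| with h1 | h1
    · have := one_le_pow₀ h1 (n := 3)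
      have : 0 < 1 / |x| := by positivity
      linarith
    · have := (one_le_div hy).2 h1
      have : 0 < |x| ^ 3 := by positivity
      linarith
  rw [abs_div, abs_of_nonneg (w_nonneg t x), abs_pow, w_eq_of_ne t hx, ← hE]
  calc Real.exp (-x ^ 2) * E / |x| ^ 3
      = Real.exp (-x ^ 2) * E * (1 / |x| ^ 3) := by ring
    _ ≤ Real.exp (-x ^ 2) * E * (1 + 1 / x ^ 4) := by gcongr
    _ = (E + E / x ^ 4) * Real.exp (-x ^ 2) := by ring
    _ ≤ (1 + 2 / t ^ 2) * Real.exp (-x ^ 2) := by gcongr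

theorem hasDerivAt_w {t : ℝ} (ht : 0 < t) (x : ℝ) :
    HasDerivAt (w t) (-2 * x * w t x + 2 * t * (w t x / x ^ 3)) x := by
  rcases eq_or_ne x 0 with rfl | hx
  · have h0 : w t 0 = 0 := by simp [w]
    rw [h0, zero_div, mul_zero, mul_zero, add_zero, hasDerivAt_iff_isLittleO]
    simp only [h0, sub_zero, smul_zero]
    have hO : w t =O[nhds 0] fun x : ℝ => x ^ 2 := by
      refine Asymptotics.IsBigO.of_bound t⁻¹ (Filter.Eventually.of_forall fun x => ?_)
      rw [Real.norm_of_nonneg (w_nonneg t x), Real.norm_of_nonneg (sq_nonneg x),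
        inv_mul_eq_div]
      exact w_le_sq_div ht x
    exact hO.trans_isLittleO (by simpa using Asymptotics.isLittleO_pow_id (𝕜 := ℝ) one_lt_two)
  · have hd : HasDerivAt (fun y : ℝ => Real.exp (-y ^ 2 - t / y ^ 2))
        (Real.exp (-x ^ 2 - t / x ^ 2) * (-(2 * x) + 2 * t / x ^ 3)) x := by
      have h1 : HasDerivAt (fun y : ℝ => y ^ 2) (2 * x) x := by simpa using hasDerivAt_pow 2 x
      have h2 := h1.fun_neg.fun_sub ((hasDerivAt_const x t).fun_div h1 (pow_ne_zero 2 hx))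
      refine h2.exp.congr_deriv ?_
      congr 1
      field_simp
      ring
    have hw : w t =ᶠ[nhds x] fun y => Real.exp (-y ^ 2 - t / y ^ 2) := by
      filter_upwards [isOpen_ne.mem_nhds hx] with y hy
      exact if_neg hy
    refine (hd.congr_of_eventuallyEq hw).congr_deriv ?_
    rw [hw.eq_of_nhds]
    ring

theorem integrable_eval_mul_w {t : ℝ} (ht : 0 < t) (p : ℝ[X]) :
    Integrable fun x => p.eval x * w t x :=
  integrable_eval_mul_of_abs_le_gaussian p (measurable_w t) (abs_w_le ht)

theorem integrable_eval_mul_w_div_cube {t : ℝ} (ht : 0 < t) (p : ℝ[X]) :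
    Integrable fun x => p.eval x * (w t x / x ^ 3) :=
  integrable_eval_mul_of_abs_le_gaussian p ((measurable_w t).div (by fun_prop))
    (abs_w_div_cube_le ht)

/-- Integration by parts against the weight. -/
theorem integral_derivative_mul_w {t : ℝ} (ht : 0 < t) (p : ℝ[X]) :
    ∫ x, p.derivative.eval x * w t x =
      2 * (∫ x, (X * p).eval x * w t x) - 2 * t * ∫ x, p.eval x * (w t x / x ^ 3) := by
  have i1 := integrable_eval_mul_w ht p.derivative
  have i2 := (integrable_eval_mul_w ht (X * p)).const_mul 2
  have i3 := (integrable_eval_mul_w_div_cube ht p).const_mul (2 * t)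
  have h0 := integral_eq_zero_of_hasDerivAt_of_integrable (f := fun x => p.eval x * w t x)
    (f' := fun x => p.derivative.eval x * w t x - 2 * ((X * p).eval x * w t x)
      + 2 * t * (p.eval x * (w t x / x ^ 3)))
    (fun x => by
      refine ((p.hasDerivAt x).fun_mul (hasDerivAt_w ht x)).congr_deriv ?_
      rw [eval_mul, eval_X]
      ring)
    ((i1.sub i2).add i3) (integrable_eval_mul_w ht p)
  rw [integral_add (by exact i1.sub i2) i3, integral_sub i1 i2, integral_const_mul,
    integral_const_mul] at h0
  linarith

/-- A monic orthogonal polynomial is orthogonal to all polynomials of smaller degree. -/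
theorem integral_mul_eq_zero_of_degree_lt {t : ℝ} (ht : 0 < t) {P : ℕ → ℝ[X]}
    (hmonic : ∀ n, (P n).Monic) (hdeg : ∀ n, (P n).natDegree = n)
    (horth : ∀ m n : ℕ, m ≠ n → ∫ x : ℝ, (P m).eval x * (P n).eval x * w t x = 0)
    (n k : ℕ) (hk : k ≤ n) (q : ℝ[X]) (hq : q.degree < k) :
    ∫ x, (P n * q).eval x * w t x = 0 := by
  induction k generalizing q with
  | zero =>
    have : q = 0 := by simpa [Polynomial.degree_eq_bot] using Nat.WithBot.lt_zero_iff.1 hq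
    simp [this]
  | succ k ih =>
    have hqk : q.degree ≤ k := by
      rw [degree_le_iff_coeff_zero]
      exact fun m hm => (degree_lt_iff_coeff_zero _ _).1 hq m (by exact_mod_cast hm)
    have hPk : (P k).degree = k := by
      rw [degree_eq_natDegree (hmonic k).ne_zero, hdeg]
    have hs : (q - C (q.coeff k) * P k).degree < k := by
      rw [degree_lt_iff_coeff_zero]
      intro m hm
      rcases hm.eq_or_lt with rfl | hm
      · have : (P k).coeff k = 1 := by
          simpa only [Monic, leadingCoeff, hdeg] using hmonic k
        simp [this]
      · have hm' : (k : WithBot ℕ) < m := by exact_mod_cast hm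
        simp [coeff_eq_zero_of_degree_lt (hqk.trans_lt hm'),
          coeff_eq_zero_of_degree_lt (hPk.trans_lt hm')]
    have e : ∀ x, (P n * q).eval x * w t x =
        (P n * (q - C (q.coeff k) * P k)).eval x * w t x +
          q.coeff k * ((P n * P k).eval x * w t x) := fun x => by
      simp only [eval_mul, eval_sub, eval_C]
      ring
    have ho := horth n k (by omega)
    simp only [← eval_mul] at ho
    rw [integral_congr_ae (.of_forall e), integral_add (integrable_eval_mul_w ht _)
      ((integrable_eval_mul_w ht _).const_mul _), ih (by omega) _ hs, integral_const_mul, ho,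
      mul_zero, add_zero]

theorem statement4
    (t : ℝ) (ht : 0 < t)
    (P : ℕ → Polynomial ℝ)
    (hmonic : ∀ n, (P n).Monic)
    (hdeg : ∀ n, (P n).natDegree = n)
    (horth : ∀ m n : ℕ, m ≠ n → ∫ x : ℝ, (P m).eval x * (P n).eval x * w t x = 0)
    (h : ℕ → ℝ)
    (hh : ∀ n, h n = ∫ x : ℝ, ((P n).eval x) ^ 2 * w t x)
    (hhpos : ∀ n, 0 < h n)
    (r : ℕ → ℝ)
    (hr : ∀ n, 1 ≤ n → r n = 2 * t / h (n - 1) *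
      ∫ y : ℝ, (P n).eval y * (P (n - 1)).eval y / y ^ 3 * w t y)
    (β : ℕ → ℝ)
    (hβ : ∀ n, 1 ≤ n → β n = h n / h (n - 1))
    (n : ℕ) (hn : 1 ≤ n) :
    β n = ((n : ℝ) + r n) / 2 := by
  obtain ⟨m, rfl⟩ : ∃ m, n = m + 1 := ⟨n - 1, by omega⟩
  have hort := integral_mul_eq_zero_of_degree_lt ht hmonic hdeg horth
  have hPdeg : ∀ k, (P k).degree = k := fun k => by
    rw [degree_eq_natDegree (hmonic k).ne_zero, hdeg]
  have hPcoeff : ∀ k, (P k).coeff k = 1 := fun k => by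
    simpa only [Monic, leadingCoeff, hdeg] using hmonic k
  have hint := integrable_eval_mul_w ht
  have key : ∀ (k : ℕ) (c : ℝ) (q : ℝ[X]), (q - C c * P k).degree < k →
      ∫ x, (P k * q).eval x * w t x = c * h k := by
    intro k c q hq
    have e : ∀ x, (P k * q).eval x * w t x =
        (P k * (q - C c * P k)).eval x * w t x + c * ((P k ^ 2).eval x * w t x) := fun x => by
      simp only [eval_mul, eval_sub, eval_C, eval_pow]
      ring
    rw [integral_congr_ae (.of_forall e), integral_add (hint _) ((hint _).const_mul _),
      hort k k le_rfl _ hq, integral_const_mul, hh, zero_add]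
    simp only [eval_pow]
  have hX : ∫ x, (P (m + 1) * (X * P m)).eval x * w t x = h (m + 1) := by
    rw [key (m + 1) 1, one_mul]
    rw [degree_lt_iff_coeff_zero]
    rintro (_ | j) hj
    · omega
    · rw [C_1, one_mul, coeff_sub, coeff_X_mul]
      rcases hj.eq_or_lt with hj | hj
      · obtain rfl : m = j := by omega
        simp [hPcoeff]
      · rw [coeff_eq_zero_of_natDegree_lt (by rw [hdeg]; omega),
          coeff_eq_zero_of_natDegree_lt (by rw [hdeg]; omega), sub_zero]
  have hD : ∫ x, (P m * derivative (P (m + 1))).eval x * w t x = (m + 1) * h m := by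
    refine key m _ _ ?_
    rw [degree_lt_iff_coeff_zero]
    intro j hj
    rw [coeff_sub, coeff_derivative, coeff_C_mul]
    rcases hj.eq_or_lt with rfl | hj
    · simp [hPcoeff]
    · rw [coeff_eq_zero_of_natDegree_lt (by rw [hdeg]; omega),
        coeff_eq_zero_of_natDegree_lt (by rw [hdeg]; omega)]
      simp
  have hD' : ∫ x, (P (m + 1) * derivative (P m)).eval x * w t x = 0 := by
    refine hort (m + 1) (m + 1) le_rfl _ ((degree_derivative_le.trans_eq (hPdeg m)).trans_lt ?_)
    exact_mod_cast m.lt_succ_self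
  have hparts := integral_derivative_mul_w ht (P (m + 1) * P m)
  have e1 : ∀ x, (derivative (P (m + 1) * P m)).eval x * w t x =
      (P m * derivative (P (m + 1))).eval x * w t x +
        (P (m + 1) * derivative (P m)).eval x * w t x := fun x => by
    rw [derivative_mul, eval_add, mul_comm (derivative _) (P m), add_mul]
  rw [integral_congr_ae (.of_forall e1), integral_add (hint _) (hint _), hD, hD',
    mul_left_comm X, hX] at hparts
  have e2 : ∀ y, (P (m + 1)).eval y * (P m).eval y / y ^ 3 * w t y =
      (P (m + 1) * P m).eval y * (w t y / y ^ 3) := fun y => by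
    rw [eval_mul]
    ring
  have hm := (hhpos m).ne'
  rw [hβ _ hn, hr _ hn, Nat.add_sub_cancel, integral_congr_ae (.of_forall e2)]
  generalize ∫ x, (P (m + 1) * P m).eval x * (w t x / x ^ 3) = I at hparts ⊢
  push_cast
  field_simp
  linarith
end
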